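/- arXiv:2502.16193 — 3 statements merged into one kernel-verified Lean document; each statement's English description precedes it below -/
import Mathlib

section
/- Let G be a connected graph with positive edge lengths and let H be a subgraph of G. Then H is an isometric subgraph of G if and only if for all x, y ∈ ∂H one has d_H(x,y) ≤ d_Ĥ(x,y). -/
open scoped ENNReal

namespace PaperIso

variable {V : Type*}

/-- The length of a walk: sum of the lengths of its edges (with multiplicity). -/
noncomputable def wLen {G : SimpleGraph V} (ℓ : Sym2 V → ℝ≥0∞) {x y : V} (w : G.Walk x y) :
    ℝ≥0∞ :=
  (w.edges.map ℓ).sum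

/-- The weighted distance in `G`: the infimum of the lengths of walks from `x` to `y`;
it equals `⊤` when there is no walk from `x` to `y`. -/
noncomputable def eDist (G : SimpleGraph V) (ℓ : Sym2 V → ℝ≥0∞) (x y : V) : ℝ≥0∞ :=
  ⨅ w : G.Walk x y, wLen ℓ w

/-- The edge lengths are positive reals (positive and finite) on every edge of `G`. -/
def PosLengths (G : SimpleGraph V) (ℓ : Sym2 V → ℝ≥0∞) : Prop :=
  ∀ e ∈ G.edgeSet, 0 < ℓ e ∧ ℓ e < ⊤

/-- The boundary `∂H`: vertices of `H` incident to some edge of `E(G) \ E(H)`. -/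
def boundary (G : SimpleGraph V) (H : G.Subgraph) : Set V :=
  {v | v ∈ H.verts ∧ ∃ u, G.Adj v u ∧ ¬ H.Adj v u}

/-- `H` is an isometric subgraph of `G` (with respect to lengths `ℓ`). -/
def IsIsometric (G : SimpleGraph V) (ℓ : Sym2 V → ℝ≥0∞) (H : G.Subgraph) : Prop :=
  ∀ x ∈ H.verts, ∀ y ∈ H.verts, eDist H.spanningCoe ℓ x y = eDist G ℓ x y

/-- `p` is a minimum-length (shortest) path with respect to lengths `ℓ`. -/
def IsShortestPath (G : SimpleGraph V) (ℓ : Sym2 V → ℝ≥0∞) {x y : V} (p : G.Walk x y) : Prop :=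
  p.IsPath ∧ ∀ q : G.Walk x y, q.IsPath → wLen ℓ p ≤ wLen ℓ q

/-- `H` is a (geodesically) convex subgraph of `G`: every minimum-length path of `G`
between vertices of `H` is contained in `H`. -/
def IsConvex (G : SimpleGraph V) (ℓ : Sym2 V → ℝ≥0∞) (H : G.Subgraph) : Prop :=
  ∀ x ∈ H.verts, ∀ y ∈ H.verts, ∀ p : G.Walk x y, IsShortestPath G ℓ p → p.toSubgraph ≤ H

/-- `ε(G,ℓ) = (1/n) · min{ℓ(π) − ℓ(π') : π, π' paths of G with ℓ(π) > ℓ(π')}`. -/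
noncomputable def eps [Fintype V] (G : SimpleGraph V) (ℓ : Sym2 V → ℝ≥0∞) : ℝ≥0∞ :=
  (⨅ (x : V) (y : V) (x' : V) (y' : V) (p : G.Path x y) (q : G.Path x' y')
      (_ : wLen ℓ (q : G.Walk x' y') < wLen ℓ (p : G.Walk x y)),
      (wLen ℓ (p : G.Walk x y) - wLen ℓ (q : G.Walk x' y'))) / (Fintype.card V : ℝ≥0∞)

open scoped Classical in
/-- The perturbed lengths `ℓ̂`: edges not in `H` are shortened by `δ`. -/
noncomputable def pert {G : SimpleGraph V} (H : G.Subgraph) (ℓ : Sym2 V → ℝ≥0∞) (δ : ℝ≥0∞) :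
    Sym2 V → ℝ≥0∞ :=
  fun e => if e ∈ H.edgeSet then ℓ e else ℓ e - δ

theorem eDist_self (G : SimpleGraph V) (ℓ : Sym2 V → ℝ≥0∞) (x : V) : eDist G ℓ x x = 0 := by
  refine le_antisymm ?_ (zero_le)
  exact (iInf_le _ SimpleGraph.Walk.nil).trans (by simp [wLen])

theorem eDist_triangle (G : SimpleGraph V) (ℓ : Sym2 V → ℝ≥0∞) (x y z : V) :
    eDist G ℓ x z ≤ eDist G ℓ x y + eDist G ℓ y z := by
  unfold eDist
  refine ENNReal.le_iInf_add_iInf fun p q => ?_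
  exact (iInf_le _ (p.append q)).trans (by simp [wLen])

theorem eDist_adj (G : SimpleGraph V) (ℓ : Sym2 V → ℝ≥0∞) {x y : V} (h : G.Adj x y) :
    eDist G ℓ x y ≤ ℓ s(x, y) :=
  (iInf_le _ (SimpleGraph.Walk.cons h SimpleGraph.Walk.nil)).trans (by simp [wLen])

theorem eDist_mono {G G' : SimpleGraph V} (h : G ≤ G') (ℓ : Sym2 V → ℝ≥0∞) (x y : V) :
    eDist G' ℓ x y ≤ eDist G ℓ x y :=
  le_iInf fun w => (iInf_le _ (w.mapLe h)).trans (by simp [wLen])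

theorem walk_bound (G : SimpleGraph V) (ℓ : Sym2 V → ℝ≥0∞) (H : G.Subgraph)
    (hb : ∀ x ∈ boundary G H, ∀ y ∈ boundary G H,
        eDist H.spanningCoe ℓ x y ≤ eDist (G.deleteEdges H.edgeSet) ℓ x y)
    {a y : V} (w : G.Walk a y) (hy : y ∈ H.verts) :
    (a ∈ H.verts → eDist H.spanningCoe ℓ a y ≤ wLen ℓ w) ∧
    (a ∉ H.verts → ∃ b ∈ boundary G H,
      eDist (G.deleteEdges H.edgeSet) ℓ a b + eDist H.spanningCoe ℓ b y ≤ wLen ℓ w) := by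
  induction w with
  | nil => exact ⟨fun _ => by simp [eDist_self], fun h => absurd hy h⟩
  | @cons a c y h w ih =>
    have hl : wLen ℓ (SimpleGraph.Walk.cons h w) = ℓ s(a, c) + wLen ℓ w := by simp [wLen]
    rw [hl]
    obtain ⟨ih1, ih2⟩ := ih hy
    by_cases hH : H.Adj a c
    · refine ⟨fun _ => ?_, fun ha => absurd (H.edge_vert hH) ha⟩
      refine (eDist_triangle _ ℓ a c y).trans ?_
      exact add_le_add (eDist_adj _ ℓ (by simpa using hH)) (ih1 (H.edge_vert hH.symm))
    · have hadj : (G.deleteEdges H.edgeSet).Adj a c := by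
        simp [SimpleGraph.deleteEdges_adj, h, hH]
      have key : ∃ b ∈ boundary G H,
          eDist (G.deleteEdges H.edgeSet) ℓ a b + eDist H.spanningCoe ℓ b y
            ≤ ℓ s(a, c) + wLen ℓ w := by
        by_cases hc : c ∈ H.verts
        · exact ⟨c, ⟨hc, a, h.symm, fun h' => hH h'.symm⟩,
            add_le_add (eDist_adj _ ℓ hadj) (ih1 hc)⟩
        · obtain ⟨b, hbb, hle⟩ := ih2 hc
          refine ⟨b, hbb, ?_⟩
          calc _ ≤ (eDist (G.deleteEdges H.edgeSet) ℓ a c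
                + eDist (G.deleteEdges H.edgeSet) ℓ c b) + eDist H.spanningCoe ℓ b y := by
                gcongr; exact eDist_triangle _ _ _ _ _
            _ ≤ _ := by
                rw [add_assoc]
                exact add_le_add (eDist_adj _ ℓ hadj) hle
      refine ⟨fun ha => ?_, fun _ => key⟩
      obtain ⟨b, hbb, hle⟩ := key
      refine (eDist_triangle _ ℓ a b y).trans (le_trans ?_ hle)
      gcongr
      exact hb a ⟨ha, c, h, hH⟩ b hbb

theorem isometric_iff_boundary [Fintype V] (G : SimpleGraph V) (ℓ : Sym2 V → ℝ≥0∞)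
    (hG : G.Connected) (hℓ : PosLengths G ℓ) (H : G.Subgraph) :
    IsIsometric G ℓ H ↔
      ∀ x ∈ boundary G H, ∀ y ∈ boundary G H,
        eDist H.spanningCoe ℓ x y ≤ eDist (G.deleteEdges H.edgeSet) ℓ x y := by
  constructor
  · intro h x hx y hy
    rw [h x hx.1 y hy.1]
    exact eDist_mono (SimpleGraph.deleteEdges_le _) ℓ x y
  · intro hb x hx y hy
    refine le_antisymm ?_ (eDist_mono H.spanningCoe_le ℓ x y)
    exact le_iInf fun w => (walk_bound G ℓ H hb w hy).1 hx

end PaperIso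
end

section
/- Let G be a connected graph with positive edge lengths and let H be a subgraph of G. Then H is a convex subgraph of G if and only if for all distinct x, y ∈ ∂H one has d_H(x,y) < d_Ĥ(x,y). -/
open scoped ENNReal

namespace PaperIso

variable {V : Type*}

lemma wLen_cons' {G : SimpleGraph V} (ℓ : Sym2 V → ℝ≥0∞) {x y z : V} (h : G.Adj x y)
    (w : G.Walk y z) : wLen ℓ (SimpleGraph.Walk.cons h w) = ℓ s(x, y) + wLen ℓ w := by
  simp [wLen]

lemma wLen_append' {G : SimpleGraph V} (ℓ : Sym2 V → ℝ≥0∞) {x y z : V} (p : G.Walk x y)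
    (w : G.Walk y z) : wLen ℓ (p.append w) = wLen ℓ p + wLen ℓ w := by
  simp [wLen]

lemma wLen_mapLe' {G G' : SimpleGraph V} (hle : G ≤ G') (ℓ : Sym2 V → ℝ≥0∞) {x y : V}
    (p : G.Walk x y) : wLen ℓ (p.mapLe hle) = wLen ℓ p := by
  simp [wLen]

lemma wLen_lt_top {G G' : SimpleGraph V} (hle : G ≤ G') (ℓ : Sym2 V → ℝ≥0∞)
    (hℓ : PosLengths G' ℓ) {x y : V} (p : G.Walk x y) : wLen ℓ p < ⊤ := by
  induction p with
  | nil => simp [wLen]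
  | cons h p ih =>
    rw [wLen_cons']
    exact ENNReal.add_lt_top.2 ⟨(hℓ _ (hle h)).2, ih⟩

open scoped Classical in
lemma wLen_bypass_le {G : SimpleGraph V} (ℓ : Sym2 V → ℝ≥0∞) {x y : V} (p : G.Walk x y) :
    wLen ℓ p.bypass ≤ wLen ℓ p := by
  have h1 : p.bypass.edges.Nodup := p.bypass_isPath.isTrail.edges_nodup
  obtain ⟨l, hperm, hsub⟩ := h1.subperm p.edges_bypass_subset_edges
  unfold wLen
  rw [← (hperm.map ℓ).sum_eq]
  exact (hsub.map ℓ).sum_le_sum (by simp)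

lemma exists_shortest [Fintype V] (G : SimpleGraph V) (ℓ : Sym2 V → ℝ≥0∞) {x y : V}
    (h : G.Reachable x y) : ∃ p : G.Walk x y, IsShortestPath G ℓ p ∧ wLen ℓ p = eDist G ℓ x y := by
  classical
  have : Nonempty (G.Path x y) := h.elim fun w => ⟨w.toPath⟩
  have : Finite (G.Path x y) := inferInstance
  obtain ⟨p, hp⟩ := Finite.exists_min (fun p : G.Path x y => wLen ℓ (p : G.Walk x y))
  refine ⟨p, ⟨p.2, fun q hq => hp ⟨q, hq⟩⟩, le_antisymm ?_ (iInf_le _ _)⟩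
  exact le_iInf fun w => (hp w.toPath).trans (wLen_bypass_le ℓ w)

/-- Walk all of whose edges lie in `H` yields containment. -/
lemma toSubgraph_le_of_edges {G : SimpleGraph V} (H : G.Subgraph) {x y : V} (p : G.Walk x y)
    (hx : x ∈ H.verts) (h : ∀ e ∈ p.edges, e ∈ H.edgeSet) : p.toSubgraph ≤ H := by
  induction p with
  | nil => simpa using hx
  | @cons a b c hadj p ih =>
    have h1 := h s(a, b) (by simp)
    have h2 : H.Adj a b := h1
    simp only [SimpleGraph.Walk.toSubgraph, sup_le_iff]
    refine ⟨SimpleGraph.subgraphOfAdj_le_of_adj H h2, ih (H.edge_vert h2.symm) fun e he => h e ?_⟩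
    simp [he]

lemma start_boundary {G : SimpleGraph V} (H : G.Subgraph) {x y : V}
    (q : (G.deleteEdges H.edgeSet).Walk x y) (hx : x ∈ H.verts) (hq : ¬ q.Nil) :
    x ∈ boundary G H := by
  cases q with
  | nil => simp at hq
  | cons h q =>
    rw [SimpleGraph.deleteEdges_adj] at h
    exact ⟨hx, _, h.1, h.2⟩

lemma close_up {G : SimpleGraph V} (ℓ : Sym2 V → ℝ≥0∞) (hℓ : PosLengths G ℓ) (H : G.Subgraph)
    (hb : ∀ x ∈ boundary G H, ∀ y ∈ boundary G H, x ≠ y →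
        eDist H.spanningCoe ℓ x y < eDist (G.deleteEdges H.edgeSet) ℓ x y)
    {a z y : V} (ha : a ∈ H.verts) (hz : z ∈ H.verts)
    (q : (G.deleteEdges H.edgeSet).Walk a z) (r : H.spanningCoe.Walk z y) :
    ∃ r' : H.spanningCoe.Walk a y, wLen ℓ r' ≤ wLen ℓ q + wLen ℓ r ∧
      (¬ q.Nil → wLen ℓ r' < wLen ℓ q + wLen ℓ r) := by
  by_cases hq : q.Nil
  · cases q with
    | nil => exact ⟨r, by simp [wLen], fun h => absurd hq h⟩
    | cons h q => simp at hq
  · suffices h : ∃ r' : H.spanningCoe.Walk a y, wLen ℓ r' < wLen ℓ q + wLen ℓ r by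
      obtain ⟨r', h⟩ := h
      exact ⟨r', h.le, fun _ => h⟩
    have hr := wLen_lt_top H.spanningCoe_le ℓ hℓ r
    suffices h : ∃ r' : H.spanningCoe.Walk a z, wLen ℓ r' < wLen ℓ q by
      obtain ⟨r', h⟩ := h
      refine ⟨r'.append r, ?_⟩
      rw [wLen_append']
      exact ENNReal.add_lt_add_right hr.ne h
    by_cases haz : a = z
    · subst haz
      refine ⟨.nil, ?_⟩
      cases q with
      | nil => simp at hq
      | @cons _ b _ h q =>
        rw [wLen_cons']
        rw [SimpleGraph.deleteEdges_adj] at h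
        have := (hℓ s(a, b) h.1).1
        simp only [wLen, SimpleGraph.Walk.edges_nil, List.map_nil, List.sum_nil]
        exact lt_of_lt_of_le this le_self_add
    · have h1 := hb a (start_boundary H q ha hq) z
        (start_boundary H q.reverse hz (by simpa using hq)) haz
      have h2 := h1.trans_le (iInf_le _ q)
      exact iInf_lt_iff.1 h2

lemma decomp {G : SimpleGraph V} (ℓ : Sym2 V → ℝ≥0∞) (hℓ : PosLengths G ℓ) (H : G.Subgraph)
    (hb : ∀ x ∈ boundary G H, ∀ y ∈ boundary G H, x ≠ y →
        eDist H.spanningCoe ℓ x y < eDist (G.deleteEdges H.edgeSet) ℓ x y)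
    {a y : V} (w : G.Walk a y) (hy : y ∈ H.verts) :
    ∃ z ∈ H.verts, ∃ (q : (G.deleteEdges H.edgeSet).Walk a z) (r : H.spanningCoe.Walk z y),
      wLen ℓ q + wLen ℓ r ≤ wLen ℓ w ∧
      ((∃ e ∈ w.edges, e ∉ H.edgeSet) → ¬ q.Nil ∨ wLen ℓ q + wLen ℓ r < wLen ℓ w) := by
  induction w with
  | nil => exact ⟨_, hy, .nil, .nil, by simp [wLen], by simp⟩
  | @cons a b c h w ih =>
    obtain ⟨z, hz, q, r, hle, hlt⟩ := ih hy
    by_cases hab : H.Adj a b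
    · obtain ⟨r', h1, h2⟩ := close_up ℓ hℓ H hb (H.edge_vert hab.symm) hz q r
      have hab' : H.spanningCoe.Adj a b := hab
      have ht := (hℓ s(a, b) h).2
      refine ⟨a, H.edge_vert hab, .nil, .cons hab' r', ?_, ?_⟩
      · rw [wLen_cons', wLen_cons']
        simp only [wLen, SimpleGraph.Walk.edges_nil, List.map_nil, List.sum_nil, zero_add]
        exact add_le_add le_rfl (h1.trans hle)
      · rintro ⟨e, he, heH⟩
        right
        rw [wLen_cons', wLen_cons']
        simp only [SimpleGraph.Walk.edges_cons, List.mem_cons] at he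
        have h3 : wLen ℓ r' < wLen ℓ w := by
          rcases he with rfl | he
          · exact absurd hab heH
          · rcases hlt ⟨e, he, heH⟩ with h4 | h4
            · exact (h2 h4).trans_le hle
            · exact h1.trans_lt h4
        have := ENNReal.add_lt_add_left ht.ne h3
        simpa [wLen] using this
    · have hab' : (G.deleteEdges H.edgeSet).Adj a b := by
        rw [SimpleGraph.deleteEdges_adj]; exact ⟨h, hab⟩
      refine ⟨z, hz, .cons hab' q, r, ?_, fun _ => Or.inl (by simp)⟩
      rw [wLen_cons', wLen_cons', add_assoc]
      exact add_le_add le_rfl hle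

theorem convex_iff_boundary [Fintype V] (G : SimpleGraph V) (ℓ : Sym2 V → ℝ≥0∞)
    (hG : G.Connected) (hℓ : PosLengths G ℓ) (H : G.Subgraph) :
    IsConvex G ℓ H ↔
      ∀ x ∈ boundary G H, ∀ y ∈ boundary G H, x ≠ y →
        eDist H.spanningCoe ℓ x y < eDist (G.deleteEdges H.edgeSet) ℓ x y := by
  classical
  constructor
  · intro hc x hx y hy hxy
    obtain ⟨p, hp, -⟩ := exists_shortest G ℓ (hG.preconnected x y)
    have hpH := hc x hx.1 y hy.1 p hp
    have hmem : ∀ e ∈ p.edges, e ∈ H.spanningCoe.edgeSet := by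
      intro e he
      have h1 : e ∈ p.toSubgraph.edgeSet := by simpa using he
      have := SimpleGraph.Subgraph.edgeSet_mono hpH h1
      simpa using this
    have hle : eDist H.spanningCoe ℓ x y ≤ wLen ℓ p := by
      refine (iInf_le _ (p.transfer H.spanningCoe hmem)).trans ?_
      simp [wLen]
    by_cases hr : (G.deleteEdges H.edgeSet).Reachable x y
    · obtain ⟨q, hq, hqe⟩ := exists_shortest _ ℓ hr
      rw [← hqe]
      refine hle.trans_lt ?_
      have hd : G.deleteEdges H.edgeSet ≤ G := SimpleGraph.deleteEdges_le _
      have hqp : (q.mapLe hd).IsPath := by simpa using hq.1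
      have hpq := hp.2 _ hqp
      rw [wLen_mapLe'] at hpq
      refine lt_of_le_of_ne hpq fun heq => ?_
      have hs : IsShortestPath G ℓ (q.mapLe hd) := by
        refine ⟨hqp, fun q' hq' => ?_⟩
        rw [wLen_mapLe', ← heq]
        exact hp.2 q' hq'
      have hqH := hc x hx.1 y hy.1 _ hs
      cases q with
      | nil => exact hxy rfl
      | @cons _ b _ h q =>
        have h1 : s(x, b) ∈ ((SimpleGraph.Walk.cons h q).mapLe hd).toSubgraph.edgeSet := by
          rw [SimpleGraph.Walk.mem_edges_toSubgraph]; simp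
        have h2 := SimpleGraph.Subgraph.edgeSet_mono hqH h1
        rw [SimpleGraph.deleteEdges_adj] at h
        exact h.2 h2
    · have : eDist (G.deleteEdges H.edgeSet) ℓ x y = ⊤ := by
        unfold eDist
        rw [iInf_eq_top]
        exact fun w => absurd ⟨w⟩ hr
      rw [this]
      exact hle.trans_lt (wLen_lt_top le_rfl ℓ hℓ p)
  · intro hb x hx y hy p hp
    apply toSubgraph_le_of_edges H p hx
    by_contra hne
    push Not at hne
    obtain ⟨z, hz, q, r, hle, hlt⟩ := decomp ℓ hℓ H hb p hy
    obtain ⟨r', h1, h2⟩ := close_up ℓ hℓ H hb hx hz q r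
    have h3 : wLen ℓ r' < wLen ℓ p := by
      rcases hlt hne with h4 | h4
      · exact (h2 h4).trans_le hle
      · exact h1.trans_lt h4
    have h5 := hp.2 _ (r'.mapLe H.spanningCoe_le).bypass_isPath
    have h6 := wLen_bypass_le ℓ (r'.mapLe H.spanningCoe_le)
    rw [wLen_mapLe'] at h6
    exact absurd h3 (not_lt.2 (h5.trans h6))

end PaperIso
end

section
/- Let G be a connected graph with positive edge lengths ℓ, let H be a subgraph of G, and let 0 < δ ≤ ε(G,ℓ). Then every path in G that is a shortest path with respect to the perturbed lengths ℓ̂ is also a shortest path with respect to the original lengths ℓ. -/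
open scoped ENNReal

namespace PaperIso

variable {V : Type*}

lemma wLen_le_pert {G : SimpleGraph V} (H : G.Subgraph) (ℓ : Sym2 V → ℝ≥0∞) (δ : ℝ≥0∞)
    (L : List (Sym2 V)) :
    (L.map ℓ).sum ≤ (L.map (pert H ℓ δ)).sum + L.length * δ := by
  induction L with
  | nil => simp
  | cons e L ih =>
    have h : ℓ e ≤ pert H ℓ δ e + δ := by
      unfold pert
      split_ifs
      · exact le_self_add
      · exact le_tsub_add
    simp only [List.map_cons, List.sum_cons, List.length_cons, Nat.cast_add, Nat.cast_one]
    refine (add_le_add h ih).trans (le_of_eq ?_)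
    ring

lemma pert_le_wLen {G : SimpleGraph V} (H : G.Subgraph) (ℓ : Sym2 V → ℝ≥0∞) (δ : ℝ≥0∞)
    (L : List (Sym2 V)) :
    (L.map (pert H ℓ δ)).sum ≤ (L.map ℓ).sum := by
  induction L with
  | nil => simp
  | cons e L ih =>
    have h : pert H ℓ δ e ≤ ℓ e := by
      unfold pert
      split_ifs
      · exact le_rfl
      · exact tsub_le_self
    simpa only [List.map_cons, List.sum_cons] using add_le_add h ih

lemma list_sum_ne_top (ℓ : Sym2 V → ℝ≥0∞) (L : List (Sym2 V)) (h : ∀ e ∈ L, ℓ e < ⊤) :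
    (L.map ℓ).sum < ⊤ := by
  induction L with
  | nil => simp
  | cons e L ih =>
    simp only [List.map_cons, List.sum_cons]
    exact ENNReal.add_lt_top.2 ⟨h e (by simp), ih fun e' he' => h e' (by simp [he'])⟩

theorem pert_shortest_path [Fintype V] (G : SimpleGraph V) (ℓ : Sym2 V → ℝ≥0∞)
    (hG : G.Connected) (hℓ : PosLengths G ℓ) (H : G.Subgraph)
    (δ : ℝ≥0∞) (hδ0 : 0 < δ) (hδ : δ ≤ eps G ℓ) {x y : V} (p : G.Walk x y)
    (hp : IsShortestPath G (pert H ℓ δ) p) :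
    IsShortestPath G ℓ p := by
  refine ⟨hp.1, fun q hq => ?_⟩
  by_contra hlt
  rw [not_le] at hlt
  have hpos : 0 < Fintype.card V := Fintype.card_pos_iff.2 ⟨x⟩
  have hn0 : (Fintype.card V : ℝ≥0∞) ≠ 0 := by exact_mod_cast hpos.ne'
  have h1 : δ * (Fintype.card V : ℝ≥0∞) ≤ wLen ℓ p - wLen ℓ q := by
    unfold eps at hδ
    rw [ENNReal.le_div_iff_mul_le (Or.inl hn0) (Or.inl (ENNReal.natCast_ne_top _))] at hδ
    refine hδ.trans ?_
    exact iInf_le_of_le x <| iInf_le_of_le y <| iInf_le_of_le x <| iInf_le_of_le y <|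
      iInf_le_of_le (⟨p, hp.1⟩ : G.Path x y) <| iInf_le_of_le (⟨q, hq⟩ : G.Path x y) <|
      iInf_le_of_le hlt le_rfl
  have htop : wLen ℓ p < ⊤ :=
    list_sum_ne_top ℓ p.edges fun e he => (hℓ e (p.edges_subset_edgeSet he)).2
  have hδtop : δ ≠ ⊤ := by
    rintro rfl
    rw [ENNReal.top_mul hn0] at h1
    exact absurd (h1.trans tsub_le_self) (not_le.2 htop)
  have h2 : wLen ℓ p - wLen ℓ q ≤ p.length * δ := by
    rw [tsub_le_iff_left]
    have ha := wLen_le_pert H ℓ δ p.edges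
    rw [SimpleGraph.Walk.length_edges] at ha
    exact ha.trans (add_le_add_left ((hp.2 q hq).trans (pert_le_wLen H ℓ δ q.edges)) _)
  have h3 : (p.length : ℝ≥0∞) < Fintype.card V := by exact_mod_cast hp.1.length_lt
  have h4 := h1.trans h2
  rw [mul_comm δ, ENNReal.mul_le_mul_iff_left hδ0.ne' hδtop] at h4
  exact absurd h4 (not_le.2 h3)

end PaperIso
end
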